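/- arXiv:1810.10086 — 6 statements merged into one kernel-verified Lean document; each statement's English description precedes it below -/
import Mathlib

section
/- Let V be a finite set with |V| = n, let b be a nonnegative integer with n > 2b, and let A ⊆ V with |A| ≤ b; set φ := |V \ A|. Let m : V → ℝ, and suppose V is partitioned into three sets R⁻, R, R⁺ with |R⁻| = |R⁺| = b (so |R| = n − 2b) such that m(j′) ≤ m(j) ≤ m(j″) for all j′ ∈ R⁻, j ∈ R, j″ ∈ R⁺. Then there exist coefficients β_j, j ∈ V \ A, with 0 ≤ β_j ≤ 1/(φ−b) for every j ∈ V \ A, Σ_{j∈V\A} β_j = 1, and (1/(n−2b)) Σ_{j∈R} m(j) = Σ_{j∈V\A} β_j m(j). -/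
open Finset

/-- If `L` has at least as many elements as `A` and its values are below those on `R`, then removing
`A` from `L ∪ R` leaves `|R| + |L| - |A|` elements whose mean is at most the mean over `R`. -/
lemma exists_subset_sdiff_mean_le {α : Type*} [DecidableEq α] {L R A : Finset α} {m : α → ℝ}
    (hR : R.Nonempty) (hdis : Disjoint L R) (hA : A.card ≤ L.card)
    (hle : ∀ i ∈ L, ∀ j ∈ R, m i ≤ m j) :
    ∃ S ⊆ (L ∪ R) \ A, S.card + A.card = R.card + L.card ∧
      (R.card : ℝ) * ∑ j ∈ S, m j ≤ S.card * ∑ j ∈ R, m j := by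
  have hAL : (A ∩ L).card + (A ∩ R).card ≤ A.card := by
    rw [← card_union_of_disjoint (hdis.mono inter_subset_right inter_subset_right)]
    exact card_le_card (union_subset inter_subset_left inter_subset_left)
  have hL : (L \ A).card + (A ∩ L).card = L.card := by
    rw [inter_comm]; exact card_sdiff_add_card_inter L A
  have hRA : (R \ A).card + (A ∩ R).card = R.card := by
    rw [inter_comm]; exact card_sdiff_add_card_inter R A
  obtain ⟨T, hT, hTcard⟩ := exists_subset_card_eq
    (show L.card - A.card + (A ∩ R).card ≤ (L \ A).card by omega)
  have hTL : T ⊆ L := hT.trans sdiff_subset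
  have hdisT : Disjoint T (R \ A) := hdis.mono hTL sdiff_subset
  obtain ⟨i, hi, hmin⟩ := exists_min_image R m hR
  have hcard : (T ∪ R \ A).card = T.card + (R \ A).card := card_union_of_disjoint hdisT
  refine ⟨T ∪ R \ A, ?_, by omega, ?_⟩
  · rw [union_sdiff_distrib]
    exact union_subset_union hT Subset.rfl
  · have hsumT : ∑ j ∈ T, m j ≤ T.card * m i := by
      simpa using sum_le_card_nsmul T m (m i) fun j hj => hle j (hTL hj) i hi
    have hsumA : (A ∩ R).card * m i ≤ ∑ j ∈ A ∩ R, m j := by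
      simpa using card_nsmul_le_sum (A ∩ R) m (m i) fun j hj => hmin j (mem_inter.1 hj).2
    have hsumR : R.card * m i ≤ ∑ j ∈ R, m j := by
      simpa using card_nsmul_le_sum R m (m i) hmin
    have hsplit : ∑ j ∈ A ∩ R, m j + ∑ j ∈ R \ A, m j = ∑ j ∈ R, m j := by
      rw [inter_comm]; exact sum_inter_add_sum_sdiff R A m
    have hTc : ((A ∩ R).card : ℝ) ≤ T.card := by exact_mod_cast (by omega)
    have hRA' : ((R \ A).card : ℝ) + (A ∩ R).card = R.card := by exact_mod_cast hRA
    rw [sum_union hdisT, hcard, Nat.cast_add]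
    have hdiff : (R.card : ℝ) * (∑ j ∈ T, m j - ∑ j ∈ A ∩ R, m j)
        ≤ R.card * ((T.card - (A ∩ R).card) * m i) :=
      mul_le_mul_of_nonneg_left (by linarith) (Nat.cast_nonneg _)
    have hmean := mul_le_mul_of_nonneg_left hsumR (sub_nonneg.2 hTc)
    rw [← eq_sub_iff_add_eq'] at hsplit
    rw [← eq_sub_iff_add_eq] at hRA'
    rw [hsplit, hRA']
    linarith

/-- **Trimmed-mean representation lemma (complete graphs).**
`V` is the set of all agents (`|V| = n`), `A ⊆ V` the Byzantine agents (`|A| ≤ b`, `n > 2b`),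
`φ = |V \ A|`, and `m j` the scalar message of agent `j`.  If `V` is partitioned into `R⁻, R, R⁺`
with `|R⁻| = |R⁺| = b` and the values on `R⁻` (resp. `R⁺`) are below (resp. above) those on `R`,
then the trimmed mean `(1/(n−2b)) ∑_{j∈R} m j` is a convex combination of the good agents'
values with all weights in `[0, 1/(φ−b)]`. -/
theorem stmt4 {α : Type*} [DecidableEq α]
    (V : Finset α) (n : ℕ) (hn : V.card = n)
    (b : ℕ) (hb : 2 * b < n)
    (A : Finset α) (hAV : A ⊆ V) (hA : A.card ≤ b)
    (φ : ℕ) (hφ : φ = (V \ A).card)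
    (m : α → ℝ)
    (Rm R Rp : Finset α)
    (hdis1 : Disjoint Rm R) (hdis2 : Disjoint R Rp) (hdis3 : Disjoint Rm Rp)
    (hunion : Rm ∪ R ∪ Rp = V)
    (hRm : Rm.card = b) (hRp : Rp.card = b)
    (horder : ∀ j' ∈ Rm, ∀ j ∈ R, ∀ j'' ∈ Rp, m j' ≤ m j ∧ m j ≤ m j'') :
    ∃ β : α → ℝ,
      (∀ j ∈ V \ A, 0 ≤ β j ∧ β j ≤ 1 / ((φ : ℝ) - b)) ∧
      ∑ j ∈ V \ A, β j = 1 ∧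
      (1 / ((n : ℝ) - 2 * b)) * ∑ j ∈ R, m j = ∑ j ∈ V \ A, β j * m j := by
  have hcardV : Rm.card + R.card + Rp.card = n := by
    rw [← hn, ← hunion, card_union_of_disjoint (disjoint_union_left.2 ⟨hdis3, hdis2⟩),
      card_union_of_disjoint hdis1]
  have hcardG : φ + A.card = n := by
    rw [hφ, ← hn]; exact card_sdiff_add_card_eq_card hAV
  have hR : R.Nonempty := card_pos.1 (by omega)
  obtain ⟨S, hS, hScard, hSsum⟩ := exists_subset_sdiff_mean_le (m := m) hR hdis1
    (hA.trans hRm.ge) fun i hi j hj => by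
      obtain ⟨k, hk⟩ : Rp.Nonempty := card_pos.1 (hRp ▸ hRm ▸ card_pos.2 ⟨i, hi⟩)
      exact (horder i hi j hj k hk).1
  obtain ⟨T, hT, hTcard, hTsum⟩ := exists_subset_sdiff_mean_le (m := fun j => -m j) hR hdis2.symm
    (hA.trans hRp.ge) fun k hk j hj => by
      obtain ⟨i, hi⟩ : Rm.Nonempty := card_pos.1 (hRm ▸ hRp ▸ card_pos.2 ⟨k, hk⟩)
      exact neg_le_neg (horder i hi j hj k hk).2
  have hSG : S ⊆ V \ A := hS.trans (sdiff_subset_sdiff (hunion ▸ subset_union_left) Subset.rfl)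
  have hTG : T ⊆ V \ A := hT.trans (sdiff_subset_sdiff
    (hunion ▸ union_subset subset_union_right
      (subset_union_right.trans subset_union_left)) Subset.rfl)
  have hSK : (S.card : ℝ) = φ - b := by
    rw [eq_sub_iff_add_eq]; exact_mod_cast (by omega)
  have hTK : (T.card : ℝ) = φ - b := by
    rw [eq_sub_iff_add_eq]; exact_mod_cast (by omega)
  have hRr : (R.card : ℝ) = n - 2 * b := by
    rw [eq_sub_iff_add_eq]; exact_mod_cast (by omega)
  have hK : (0 : ℝ) < φ - b := by
    rw [← hSK]; exact_mod_cast (by omega)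
  have hr : (0 : ℝ) < n - 2 * b := by
    rw [← hRr]; exact_mod_cast card_pos.2 hR
  simp only [sum_neg_distrib, mul_neg, neg_le_neg_iff] at hTsum
  rw [hSK, hRr] at hSsum
  rw [hTK, hRr] at hTsum
  set K : ℝ := φ - b
  set r : ℝ := n - 2 * b
  have hmem : 1 / r * ∑ j ∈ R, m j ∈ Set.Icc (1 / K * ∑ j ∈ S, m j) (1 / K * ∑ j ∈ T, m j) := by
    constructor <;> rw [one_div_mul_eq_div, one_div_mul_eq_div, div_le_div_iff₀ (by assumption)
      (by assumption)] <;> linarith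
  rw [← segment_eq_Icc (hmem.1.trans hmem.2)] at hmem
  obtain ⟨u, v, hu, hv, huv, hmean⟩ := hmem
  refine ⟨fun j => 1 / K * (u * (if j ∈ S then 1 else 0) + v * (if j ∈ T then 1 else 0)),
    fun j _ => ⟨?_, ?_⟩, ?_, ?_⟩
  · positivity
  · refine mul_le_of_le_one_right (by positivity) ?_
    split_ifs <;> linarith
  · rw [← mul_sum, sum_add_distrib, ← mul_sum, ← mul_sum, sum_ite_mem, sum_ite_mem,
      inter_eq_right.2 hSG, inter_eq_right.2 hTG, sum_const, sum_const, nsmul_one, nsmul_one,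
      hSK, hTK, ← add_mul, huv, one_mul, one_div_mul_cancel hK.ne']
  · have hind (U : Finset α) (hU : U ⊆ V \ A) :
        ∑ j ∈ V \ A, (if j ∈ U then (1 : ℝ) else 0) * m j = ∑ j ∈ U, m j := by
      simp only [ite_mul, one_mul, zero_mul, sum_ite_mem, inter_eq_right.2 hU]
    simp only [mul_assoc, add_mul, ← mul_sum, sum_add_distrib, hind S hSG, hind T hTG]
    rw [← hmean, smul_eq_mul, smul_eq_mul]
    ring
end

section
/- Let S be a finite set, b a nonnegative integer with |S| > 2b, and A ⊆ S with |A| ≤ b and |S \ A| > b. Let m : S → ℝ and suppose S is partitioned into three sets R⁻, R, R⁺ with |R⁻| = |R⁺| = b such that m(j′) ≤ m(j) ≤ m(j″) for all j′ ∈ R⁻, j ∈ R, j″ ∈ R⁺. Then there exist coefficients β_j ≥ 0, j ∈ S \ A, with Σ_{j∈S\A} β_j = 1 and (1/|R|) Σ_{j∈R} m(j) = Σ_{j∈S\A} β_j m(j), and there exists a subset B ⊆ S \ A with |B| ≥ |S \ A| − b such that β_j ≥ 1/(2(|S \ A| − b)) for every j ∈ B. -/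
open Finset

/-- If `F` has at least as many elements as `R`, and the values on `F \ R` are below those on `R`,
then the average over `F` is at most the average over `R`. -/
theorem card_mul_sum_le_card_mul_sum {α : Type*} [DecidableEq α] {F R : Finset α} {m : α → ℝ}
    (hcard : R.card ≤ F.card) (hle : ∀ x ∈ F \ R, ∀ y ∈ R, m x ≤ m y) (hR : R.Nonempty) :
    (R.card : ℝ) * ∑ j ∈ F, m j ≤ F.card * ∑ j ∈ R, m j := by
  obtain ⟨y, hy, hmin⟩ := R.exists_min_image m hR
  have hF : ∑ j ∈ F \ R, m j ≤ (F \ R).card * m y := by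
    simpa using sum_le_card_nsmul (F \ R) m (m y) fun x hx => hle x hx y hy
  have hRF : (R \ F).card * m y ≤ ∑ j ∈ R \ F, m j := by
    simpa using card_nsmul_le_sum (R \ F) m (m y) fun x hx => hmin x (mem_sdiff.1 hx).1
  have hI : (F ∩ R).card * m y ≤ ∑ j ∈ F ∩ R, m j := by
    simpa using card_nsmul_le_sum (F ∩ R) m (m y) fun x hx => hmin x (mem_inter.1 hx).2
  have hsF := sum_inter_add_sum_sdiff F R m
  have hsR := sum_inter_add_sum_sdiff R F m
  have hcF : ((F ∩ R).card : ℝ) + (F \ R).card = F.card := mod_cast card_inter_add_card_sdiff F R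
  have hcR : ((F ∩ R).card : ℝ) + (R \ F).card = R.card := by
    rw [inter_comm]; exact mod_cast card_inter_add_card_sdiff R F
  rw [inter_comm R F] at hsR
  have hcard' : (0 : ℝ) ≤ F.card - R.card := sub_nonneg.2 (mod_cast hcard)
  have h₁ := mul_le_mul_of_nonneg_left hF (Nat.cast_nonneg (α := ℝ) R.card)
  have h₂ := mul_le_mul_of_nonneg_left hRF (Nat.cast_nonneg (α := ℝ) F.card)
  have h₃ := mul_le_mul_of_nonneg_left hI hcard'
  rw [← hsF, ← hsR]
  have key : (R.card : ℝ) * ((F \ R).card * m y) =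
      F.card * ((R \ F).card * m y) + (F.card - R.card) * ((F ∩ R).card * m y) := by
    rw [← hcF, ← hcR]; ring
  linarith

/-- A real number between the averages over two `k`-element subsets of `T` is a convex combination
of the values on `T` which gives weight at least `1 / (2 * k)` to every element of some
`k`-element subset. -/
theorem exists_weights_of_average_le_of_le_average {α : Type*} [DecidableEq α] {T P Q : Finset α}
    {m : α → ℝ} {k : ℕ} {y : ℝ} (hk : 0 < k) (hPT : P ⊆ T) (hQT : Q ⊆ T)
    (hP : P.card = k) (hQ : Q.card = k)
    (hPy : (∑ j ∈ P, m j) / k ≤ y) (hyQ : y ≤ (∑ j ∈ Q, m j) / k) :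
    ∃ β : α → ℝ, (∀ j ∈ T, 0 ≤ β j) ∧ ∑ j ∈ T, β j = 1 ∧ y = ∑ j ∈ T, β j * m j ∧
      ∃ B ⊆ T, B.card = k ∧ ∀ j ∈ B, 1 / (2 * (k : ℝ)) ≤ β j := by
  have hk' : (0 : ℝ) < k := mod_cast hk
  obtain ⟨s, t, hs, ht, hst, rfl⟩ : y ∈ segment ℝ ((∑ j ∈ P, m j) / k) ((∑ j ∈ Q, m j) / k) := by
    rw [segment_eq_Icc (hPy.trans hyQ)]; exact ⟨hPy, hyQ⟩
  have hsum (f : α → ℝ) : ∑ j ∈ T, ((if j ∈ P then s / k else 0) + (if j ∈ Q then t / k else 0)) * f j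
      = s / k * ∑ j ∈ P, f j + t / k * ∑ j ∈ Q, f j := by
    simp only [add_mul, ite_mul, zero_mul, sum_add_distrib, sum_ite_mem, mul_sum,
      inter_eq_right.2 hPT, inter_eq_right.2 hQT]
  have hs' : 0 ≤ s / k := by positivity
  have ht' : 0 ≤ t / k := by positivity
  have half {u : ℝ} (hu : 1 / 2 ≤ u) : 1 / (2 * (k : ℝ)) ≤ u / k := by
    rw [← div_div]; gcongr
  refine ⟨fun j => (if j ∈ P then s / k else 0) + (if j ∈ Q then t / k else 0), fun j _ => ?_,
    ?_, ?_, ?_⟩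
  · positivity
  · have h := hsum fun _ => 1
    simp only [mul_one, sum_const, nsmul_eq_mul, hP, hQ] at h
    rw [h, div_mul_cancel₀ _ hk'.ne', div_mul_cancel₀ _ hk'.ne', hst]
  · rw [hsum, smul_eq_mul, smul_eq_mul]; ring
  · rcases le_total (1 / 2) s with h | h
    · refine ⟨P, hPT, hP, fun j hj => ?_⟩
      have := half h
      simp only [hj, if_true]
      split_ifs <;> linarith
    · refine ⟨Q, hQT, hQ, fun j hj => ?_⟩
      have := half (u := t) (by linarith)
      simp only [hj, if_true]
      split_ifs <;> linarith

/-- **Trimmed-mean representation lemma (incomplete networks).**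
`S` is the closed in-neighborhood of a good agent, `A ⊆ S` the Byzantine agents in it
(`|A| ≤ b`, `|S| > 2b`, `|S \ A| > b`), and `m j` the scalar message of agent `j`.  If `S` is
partitioned into `R⁻, R, R⁺` with `|R⁻| = |R⁺| = b` and the values on `R⁻` (resp. `R⁺`) are
below (resp. above) those on `R`, then the trimmed mean `(1/|R|) ∑_{j∈R} m j` is a convex
combination of the good agents' values, and a subset `B` of at least `|S \ A| − b` good agents
receives weight at least `1/(2(|S \ A| − b))` each. -/
theorem stmt5 {α : Type*} [DecidableEq α]
    (S : Finset α) (b : ℕ) (hb : 2 * b < S.card)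
    (A : Finset α) (hAS : A ⊆ S) (hA : A.card ≤ b)
    (hgood : b < (S \ A).card)
    (m : α → ℝ)
    (Rm R Rp : Finset α)
    (hdis1 : Disjoint Rm R) (hdis2 : Disjoint R Rp) (hdis3 : Disjoint Rm Rp)
    (hunion : Rm ∪ R ∪ Rp = S)
    (hRm : Rm.card = b) (hRp : Rp.card = b)
    (horder : ∀ j' ∈ Rm, ∀ j ∈ R, ∀ j'' ∈ Rp, m j' ≤ m j ∧ m j ≤ m j'') :
    ∃ β : α → ℝ,
      (∀ j ∈ S \ A, 0 ≤ β j) ∧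
      ∑ j ∈ S \ A, β j = 1 ∧
      (1 / (R.card : ℝ)) * ∑ j ∈ R, m j = ∑ j ∈ S \ A, β j * m j ∧
      ∃ B ⊆ S \ A, (S \ A).card - b ≤ B.card ∧
        ∀ j ∈ B, 1 / (2 * (((S \ A).card : ℝ) - b)) ≤ β j := by
  have hcS : R.card + 2 * b = S.card := by
    rw [← hunion, card_union_of_disjoint (disjoint_union_left.2 ⟨hdis3, hdis2⟩),
      card_union_of_disjoint hdis1]
    omega
  have hcA : (S \ A).card + A.card = S.card := card_sdiff_add_card_eq_card hAS
  have hR : R.Nonempty := card_pos.1 (by omega)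
  obtain ⟨hmS, hRS, hpS⟩ : Rm ⊆ S ∧ R ⊆ S ∧ Rp ⊆ S := by
    subst hunion; refine ⟨?_, ?_, ?_⟩ <;> intro x hx <;> simp [hx]
  have hexists (X Y : Finset α) (hS : R ∪ X ∪ Y = S) (hY : Y.card = b) :
      ∃ P, P ⊆ (R ∪ X) \ A ∧ P.card = (S \ A).card - b := by
    refine exists_subset_card_eq ?_
    have hsub : S \ A ⊆ (R ∪ X) \ A ∪ Y := by
      rw [← hS, union_sdiff_distrib]
      exact union_subset_union_right sdiff_subset
    have := (card_le_card hsub).trans (card_union_le _ _)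
    omega
  obtain ⟨P, hP, hPk⟩ := hexists Rm Rp (by rw [union_comm R]; exact hunion) hRp
  obtain ⟨Q, hQ, hQk⟩ := hexists Rp Rm (by rw [← hunion]; ac_rfl) hRm
  have hmR : ∀ x ∈ Rm, ∀ y ∈ R, m x ≤ m y := fun x hx y hy => by
    obtain ⟨z, hz⟩ : Rp.Nonempty := card_pos.1 (by rw [hRp, ← hRm]; exact card_pos.2 ⟨x, hx⟩)
    exact (horder x hx y hy z hz).1
  have hpR : ∀ x ∈ Rp, ∀ y ∈ R, m y ≤ m x := fun x hx y hy => by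
    obtain ⟨z, hz⟩ : Rm.Nonempty := card_pos.1 (by rw [hRm, ← hRp]; exact card_pos.2 ⟨x, hx⟩)
    exact (horder z hz y hy x hx).2
  have hmem {F X : Finset α} (hF : F ⊆ (R ∪ X) \ A) {x : α} (hx : x ∈ F \ R) : x ∈ X := by
    have := hF (mem_sdiff.1 hx).1
    simp_all
  have hlow := card_mul_sum_le_card_mul_sum (F := P) (m := m) (by omega)
    (fun x hx => hmR x (hmem hP hx)) hR
  have hupp := card_mul_sum_le_card_mul_sum (F := Q) (m := fun j => -m j) (by omega)
    (fun x hx y hy => neg_le_neg (hpR x (hmem hQ hx) y hy)) hR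
  rw [hPk] at hlow
  simp only [hQk, sum_neg_distrib, mul_neg, neg_le_neg_iff] at hupp
  have hk : 0 < (S \ A).card - b := by omega
  have hk' : (0 : ℝ) < ((S \ A).card - b : ℕ) := mod_cast hk
  have hr : (0 : ℝ) < R.card := mod_cast hR.card_pos
  have hsubS (X : Finset α) (hX : X ⊆ S) : (R ∪ X) \ A ⊆ S \ A :=
    sdiff_subset_sdiff (union_subset hRS hX) le_rfl
  obtain ⟨β, hβ, hβ1, hβm, B, hBS, hB, hBβ⟩ := exists_weights_of_average_le_of_le_average
    (y := 1 / (R.card : ℝ) * ∑ j ∈ R, m j) hk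
    (hP.trans (hsubS Rm hmS)) (hQ.trans (hsubS Rp hpS)) hPk hQk
    (by rw [one_div_mul_eq_div, div_le_div_iff₀ hk' hr]; linarith)
    (by rw [one_div_mul_eq_div, div_le_div_iff₀ hr hk']; linarith)
  rw [Nat.cast_sub hgood.le] at hBβ
  exact ⟨β, hβ, hβ1, hβm, B, hBS, hB.ge, hBβ⟩
end

section
/- Let λ ∈ (0,1) and let t ≥ 1 be an integer such that m₀ := log(λt/2)/log(1/λ) is a nonnegative integer with m₀ ≤ t/2. Then Σ_{m=0}^{t−1} λ^m/(t−m) ≤ 4/((1−λ) t). -/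
theorem geom_sum_le_inv_one_sub {x : ℝ} (hx0 : 0 ≤ x) (hx1 : x < 1) (n : ℕ) :
    ∑ i ∈ Finset.range n, x ^ i ≤ (1 - x)⁻¹ := by
  rw [← tsum_geometric_of_lt_one hx0 hx1]
  exact (summable_geometric_of_lt_one hx0 hx1).sum_le_tsum _ fun i _ => pow_nonneg hx0 i

/-- **Discounted harmonic-type sum bound.**
For `λ ∈ (0,1)` and `t ≥ 1` such that `m₀ = log(λt/2)/log(1/λ)` is a nonnegative integer
with `m₀ ≤ t/2`, we have `∑_{m=0}^{t-1} λ^m/(t−m) ≤ 4/((1−λ)t)`. -/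
theorem stmt12 (lam : ℝ) (hlam0 : 0 < lam) (hlam1 : lam < 1)
    (t : ℕ) (ht : 1 ≤ t)
    (m₀ : ℕ) (hm₀ : (m₀ : ℝ) = Real.log (lam * t / 2) / Real.log (1 / lam))
    (hm₀le : (m₀ : ℝ) ≤ (t : ℝ) / 2) :
    ∑ m ∈ Finset.range t, lam ^ m / ((t : ℝ) - m) ≤ 4 / ((1 - lam) * t) := by
  have ht0 : (0 : ℝ) < t := by exact_mod_cast ht
  have hlog : 0 < Real.log (1 / lam) := Real.log_pos (one_lt_one_div hlam0 hlam1)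
  have hpow : lam ^ (m₀ + 1) = 2 / t := by
    have h : (1 / lam) ^ m₀ = lam * t / 2 := by
      apply Real.log_injOn_pos (Set.mem_Ioi.2 (by positivity)) (Set.mem_Ioi.2 (by positivity))
      rw [Real.log_pow, hm₀, div_mul_cancel₀ _ hlog.ne']
    rw [one_div, inv_pow, inv_eq_iff_eq_inv] at h
    rw [pow_succ, h]
    field_simp
  have hlt : m₀ + 1 ≤ t := by
    have : 2 * m₀ ≤ t := by
      have : (2 * m₀ : ℝ) ≤ t := by linarith
      exact_mod_cast this
    omega
  obtain ⟨k, hk⟩ := Nat.exists_eq_add_of_le hlt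
  have hhead : ∑ m ∈ Finset.range (m₀ + 1), lam ^ m / ((t : ℝ) - m)
      ≤ 2 / t * (1 - lam)⁻¹ := by
    refine le_trans ?_ (mul_le_mul_of_nonneg_left
      (geom_sum_le_inv_one_sub hlam0.le hlam1 (m₀ + 1)) (by positivity))
    rw [Finset.mul_sum]
    refine Finset.sum_le_sum fun m hm => ?_
    have hm' : (m : ℝ) ≤ m₀ := by
      exact_mod_cast Nat.lt_succ_iff.1 (Finset.mem_range.1 hm)
    calc lam ^ m / ((t : ℝ) - m) ≤ lam ^ m / (t / 2) := by
          gcongr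
          linarith
      _ = 2 / t * lam ^ m := by field_simp
  have htail : ∑ i ∈ Finset.range k, lam ^ (m₀ + 1 + i) / ((t : ℝ) - (m₀ + 1 + i : ℕ))
      ≤ 2 / t * (1 - lam)⁻¹ := by
    refine le_trans ?_ (mul_le_mul_of_nonneg_left
      (geom_sum_le_inv_one_sub hlam0.le hlam1 k) (by positivity))
    rw [Finset.mul_sum]
    refine Finset.sum_le_sum fun i hi => ?_
    rw [← hpow, ← pow_add]
    refine div_le_self (by positivity) ?_
    have hi' : m₀ + 1 + i + 1 ≤ t := by
      have := Finset.mem_range.1 hi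
      omega
    have : ((m₀ + 1 + i : ℕ) : ℝ) + 1 ≤ t := by exact_mod_cast hi'
    linarith
  have hsplit : ∑ m ∈ Finset.range t, lam ^ m / ((t : ℝ) - m)
      = ∑ m ∈ Finset.range (m₀ + 1), lam ^ m / ((t : ℝ) - m)
        + ∑ i ∈ Finset.range k, lam ^ (m₀ + 1 + i) / ((t : ℝ) - (m₀ + 1 + i : ℕ)) := by
    rw [← Finset.sum_range_add (fun m : ℕ => lam ^ m / ((t : ℝ) - m)), ← hk]
  have hsub : 0 < 1 - lam := sub_pos.2 hlam1
  calc ∑ m ∈ Finset.range t, lam ^ m / ((t : ℝ) - m)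
      ≤ 2 / t * (1 - lam)⁻¹ + 2 / t * (1 - lam)⁻¹ := hsplit.trans_le (add_le_add hhead htail)
    _ = 4 / ((1 - lam) * t) := by
      field_simp
      norm_num
end

section
/- Under the one-step setup below, max_{i∈G} ‖x′_i − θ*‖_∞ ≤ ρ · max_{j∈G} ‖x_j − θ*‖_∞ + C₀ · max_{j∈G} ‖v_j‖. -/
open Finset Matrix

/-- Every coordinate of `Mᵀ v` is bounded by the `ℓ²` operator norm of `M` times `‖v‖`. -/
lemma abs_transpose_mulVec_apply_le {m n : Type*} [Fintype m] [Fintype n] [DecidableEq n]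
    (M : Matrix m n ℝ) (v : EuclideanSpace ℝ m) (k : n) :
    |(Mᵀ *ᵥ (fun a => v a)) k| ≤
      ‖LinearMap.toContinuousLinearMap (Matrix.toEuclideanLin M)‖ * ‖v‖ := by
  set L := LinearMap.toContinuousLinearMap (Matrix.toEuclideanLin M)
  have h_inner : (Mᵀ *ᵥ (fun a => v a)) k = inner ℝ (L (EuclideanSpace.single k 1)) v := by
    simp [L, PiLp.inner_apply, Matrix.mulVec, dotProduct, Matrix.toLpLin_apply, mul_comm]
  have h_col : ‖L (EuclideanSpace.single k 1)‖ ≤ ‖L‖ := by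
    simpa using L.le_opNorm (EuclideanSpace.single k 1)
  rw [h_inner]
  exact (abs_real_inner_le_norm _ _).trans (by gcongr)

/-- Every coordinate of `A y` is bounded by the `ℓ¹` norm of the corresponding column of the
symmetric matrix `A` times the sup norm of `y`. -/
lemma Matrix.IsSymm.abs_mulVec_apply_le {n : Type*} [Fintype n] {A : Matrix n n ℝ}
    (hA : A.IsSymm) (y : n → ℝ) (k : n) :
    |(A *ᵥ y) k| ≤ (∑ k', |A k' k|) * ‖y‖ := by
  rw [Matrix.mulVec, dotProduct, Finset.sum_mul]
  refine (Finset.abs_sum_le_sum_abs _ _).trans (Finset.sum_le_sum fun k' _ => ?_)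
  rw [abs_mul, hA.apply]
  gcongr
  exact norm_le_pi_norm y k'

/-- **One-step contraction of the trimmed-mean update.**
If every coordinate of each updated vector `x' i` is a convex combination (with weights at most
`1/(φ−b)`) of the corresponding coordinates of `z j = x j − HⱼᵀHⱼ(x j − θ*) + Hⱼᵀ v j` over the
good agents, then `maxᵢ ‖x' i − θ*‖_∞ ≤ ρ · maxⱼ ‖x j − θ*‖_∞ + C₀ · maxⱼ ‖v j‖`. -/
theorem stmt13
    {ι : Type*} [Fintype ι] [Nonempty ι]
    (b : ℕ) (hb : b < Fintype.card ι)
    (d : ℕ) [NeZero d]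
    (θ : Fin d → ℝ)
    (n : ι → ℕ)
    (H : (j : ι) → Matrix (Fin (n j)) (Fin d) ℝ)
    (ρ C₀ : ℝ)
    (hρ : ρ = Finset.univ.sup' Finset.univ_nonempty (fun k : Fin d =>
        (∑ j : ι, ∑ k' : Fin d, |((1 : Matrix (Fin d) (Fin d) ℝ) - (H j)ᵀ * H j) k' k|) /
          ((Fintype.card ι : ℝ) - b)))
    (hC₀ : C₀ = Finset.univ.sup' Finset.univ_nonempty (fun j : ι =>
        ‖LinearMap.toContinuousLinearMap (Matrix.toEuclideanLin (H j))‖))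
    (x x' : ι → Fin d → ℝ)
    (v : (j : ι) → EuclideanSpace ℝ (Fin (n j)))
    (β : ι → ι → Fin d → ℝ)
    (hβnn : ∀ i j k, 0 ≤ β i j k)
    (hβub : ∀ i j k, β i j k ≤ ((Fintype.card ι : ℝ) - b)⁻¹)
    (hβsum : ∀ i k, ∑ j, β i j k = 1)
    (hupd : ∀ i k, x' i k = ∑ j, β i j k *
        (x j k - (((H j)ᵀ * H j) *ᵥ (x j - θ)) k + ((H j)ᵀ *ᵥ (fun a => v j a)) k)) :
    Finset.univ.sup' Finset.univ_nonempty (fun i => ‖x' i - θ‖) ≤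
      ρ * Finset.univ.sup' Finset.univ_nonempty (fun j => ‖x j - θ‖) +
        C₀ * Finset.univ.sup' Finset.univ_nonempty (fun j => ‖v j‖) := by
  set X := Finset.univ.sup' Finset.univ_nonempty (fun j => ‖x j - θ‖)
  set V := Finset.univ.sup' Finset.univ_nonempty (fun j => ‖v j‖)
  have hX (j : ι) : ‖x j - θ‖ ≤ X :=
    Finset.le_sup' (fun j => ‖x j - θ‖) (Finset.mem_univ j)
  have hV (j : ι) : ‖v j‖ ≤ V := Finset.le_sup' (fun j => ‖v j‖) (Finset.mem_univ j)
  have hX0 : 0 ≤ X := (norm_nonneg _).trans (hX (Classical.arbitrary ι))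
  have hC (j : ι) : ‖LinearMap.toContinuousLinearMap (Matrix.toEuclideanLin (H j))‖ ≤ C₀ :=
    hC₀ ▸ Finset.le_sup'
      (fun j => ‖LinearMap.toContinuousLinearMap (Matrix.toEuclideanLin (H j))‖)
      (Finset.mem_univ j)
  have hC0 : 0 ≤ C₀ := (norm_nonneg _).trans (hC (Classical.arbitrary ι))
  have hφ : (0 : ℝ) < (Fintype.card ι : ℝ) - b := sub_pos.2 (by exact_mod_cast hb)
  let A : ι → Matrix (Fin d) (Fin d) ℝ := fun j => 1 - (H j)ᵀ * H j
  have hA (j : ι) : (A j).IsSymm := by simp [A, Matrix.IsSymm, Matrix.transpose_mul]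
  have hρk (k : Fin d) :
      ∑ j, ((Fintype.card ι : ℝ) - b)⁻¹ * ∑ k', |A j k' k| ≤ ρ := by
    rw [← Finset.mul_sum, inv_mul_eq_div, hρ]
    exact Finset.le_sup' (fun k : Fin d =>
      (∑ j : ι, ∑ k' : Fin d, |A j k' k|) / ((Fintype.card ι : ℝ) - b)) (Finset.mem_univ k)
  have hρ0 : 0 ≤ ρ := le_trans (by positivity) (hρk 0)
  have hV0 : 0 ≤ V := (norm_nonneg _).trans (hV (Classical.arbitrary ι))
  refine Finset.sup'_le _ _ fun i _ => (pi_norm_le_iff_of_nonneg (by positivity)).2 fun k => ?_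
  have h_err : (x' i - θ) k = ∑ j, β i j k * (A j *ᵥ (x j - θ)) k +
      ∑ j, β i j k * ((H j)ᵀ *ᵥ (fun a => v j a)) k := by
    have hθ : θ k = ∑ j, β i j k * θ k := by rw [← Finset.sum_mul, hβsum, one_mul]
    rw [Pi.sub_apply, hupd, hθ, ← Finset.sum_sub_distrib, ← Finset.sum_add_distrib]
    refine Finset.sum_congr rfl fun j _ => ?_
    simp only [A, Matrix.sub_mulVec, Matrix.one_mulVec, Pi.sub_apply]
    ring
  rw [h_err, Real.norm_eq_abs]
  refine (abs_add_le _ _).trans (add_le_add ?_ ?_)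
  · calc |∑ j, β i j k * (A j *ᵥ (x j - θ)) k|
        ≤ ∑ j, |β i j k * (A j *ᵥ (x j - θ)) k| := Finset.abs_sum_le_sum_abs _ _
      _ ≤ ∑ j, ((Fintype.card ι : ℝ) - b)⁻¹ * ((∑ k', |A j k' k|) * X) := by
        refine Finset.sum_le_sum fun j _ => ?_
        rw [abs_mul, abs_of_nonneg (hβnn i j k)]
        refine mul_le_mul (hβub i j k) (((hA j).abs_mulVec_apply_le _ k).trans ?_)
          (abs_nonneg _) (by positivity)
        gcongr
        exact hX j
      _ = (∑ j, ((Fintype.card ι : ℝ) - b)⁻¹ * ∑ k', |A j k' k|) * X := by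
        simp only [← mul_assoc, ← Finset.sum_mul]
      _ ≤ ρ * X := by gcongr; exact hρk k
  · calc |∑ j, β i j k * ((H j)ᵀ *ᵥ (fun a => v j a)) k|
        ≤ ∑ j, |β i j k * ((H j)ᵀ *ᵥ (fun a => v j a)) k| := Finset.abs_sum_le_sum_abs _ _
      _ ≤ ∑ j, β i j k * (C₀ * V) := by
        refine Finset.sum_le_sum fun j _ => ?_
        rw [abs_mul, abs_of_nonneg (hβnn i j k)]
        exact mul_le_mul_of_nonneg_left ((abs_transpose_mulVec_apply_le (H j) (v j) k).trans
          (mul_le_mul (hC j) (hV j) (norm_nonneg _) hC0)) (hβnn i j k)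
      _ = C₀ * V := by rw [← Finset.sum_mul, hβsum, one_mul]
end

section
/- Under the deterministic trimmed-mean dynamics below, for every t ≥ 1, max_{i∈G} ‖x_i(t) − θ*‖_∞ ≤ ρ^t · max_{i∈G} ‖x_i(0) − θ*‖_∞ + C₀ · Σ_{j∈G} Σ_{m=0}^{t−1} ρ^m ‖(1/(t−m)) Σ_{r=1}^{t−m} w_j(r)‖. -/
open Finset Matrix

/-- Coordinates of `Aᵀ v` are bounded by the operator norm of `A` times the Euclidean norm of `v`. -/
theorem abs_transpose_mulVec_le {m d : ℕ} (A : Matrix (Fin m) (Fin d) ℝ)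
    (v : EuclideanSpace ℝ (Fin m)) (k : Fin d) :
    |(Aᵀ *ᵥ (fun a => v a)) k| ≤
      ‖LinearMap.toContinuousLinearMap (Matrix.toEuclideanLin A)‖ * ‖v‖ := by
  set L := LinearMap.toContinuousLinearMap (Matrix.toEuclideanLin A) with hL
  have h : (Aᵀ *ᵥ (fun a => v a)) k = inner ℝ (L (EuclideanSpace.single k 1)) v := by
    simp [hL, PiLp.inner_apply, Matrix.mulVec, dotProduct, Matrix.toLpLin_apply, mul_comm]
  rw [h]
  refine (abs_real_inner_le_norm _ _).trans ?_
  gcongr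
  simpa using L.le_opNorm (EuclideanSpace.single k 1)

/-- Coordinates of `A v` are bounded by the `ℓ¹` norm of a row of `A` times the sup norm of `v`. -/
theorem abs_mulVec_le_sum_abs_mul_norm {m d : ℕ} (A : Matrix (Fin m) (Fin d) ℝ) (v : Fin d → ℝ)
    (k : Fin m) : |(A *ᵥ v) k| ≤ (∑ l, |A k l|) * ‖v‖ := by
  rw [Matrix.mulVec, dotProduct, Finset.sum_mul]
  refine (Finset.abs_sum_le_sum_abs _ _).trans (Finset.sum_le_sum fun l _ => ?_)
  rw [abs_mul]
  gcongr
  exact norm_le_pi_norm v l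

/-- Unrolling the affine recursion `M (t + 1) ≤ ρ M t + g (t + 1)`. -/
theorem le_pow_mul_add_sum_of_succ_le {M g : ℕ → ℝ} {ρ : ℝ} (hρ : 0 ≤ ρ)
    (h : ∀ t, M (t + 1) ≤ ρ * M t + g (t + 1)) (t : ℕ) :
    M t ≤ ρ ^ t * M 0 + ∑ m ∈ Finset.range t, ρ ^ m * g (t - m) := by
  induction t with
  | zero => simp
  | succ t ih =>
    rw [Finset.sum_range_succ']
    have hs : ∑ m ∈ Finset.range t, ρ ^ (m + 1) * g (t + 1 - (m + 1)) =
        ρ * ∑ m ∈ Finset.range t, ρ ^ m * g (t - m) := by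
      rw [Finset.mul_sum]
      refine Finset.sum_congr rfl fun m _ => ?_
      rw [Nat.add_sub_add_right, pow_succ]
      ring
    rw [hs]
    calc M (t + 1) ≤ ρ * M t + g (t + 1) := h t
      _ ≤ ρ * (ρ ^ t * M 0 + ∑ m ∈ Finset.range t, ρ ^ m * g (t - m)) + g (t + 1) := by gcongr
      _ = _ := by simp only [pow_zero, one_mul, Nat.sub_zero, pow_succ]; ring

/-- **Deterministic error recursion for the trimmed-mean dynamics (complete graphs).**
Noise `w j r` denotes the measurement noise of good agent `j` at time `r + 1`, so that
`(1/t) ∑_{r=1}^t w_j(r)` is `(t : ℝ)⁻¹ • ∑ r ∈ Finset.range t, w j r`.  Under the trimmed-mean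
dynamics with convex weights bounded by `1/(φ−b)`, for every `t ≥ 1`,
`maxᵢ ‖x i t − θ*‖_∞ ≤ ρ^t maxᵢ ‖x i 0 − θ*‖_∞ + C₀ ∑ⱼ ∑_{m=0}^{t-1} ρ^m ‖(1/(t−m)) ∑_{r=1}^{t−m} w_j(r)‖`. -/
theorem stmt14
    {ι : Type*} [Fintype ι] [Nonempty ι]
    (b : ℕ) (hb : b < Fintype.card ι)
    (d : ℕ) [NeZero d]
    (θ : Fin d → ℝ)
    (n : ι → ℕ)
    (H : (j : ι) → Matrix (Fin (n j)) (Fin d) ℝ)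
    (w : (j : ι) → ℕ → EuclideanSpace ℝ (Fin (n j)))
    (ρ C₀ : ℝ)
    (hρ : ρ = Finset.univ.sup' Finset.univ_nonempty (fun k : Fin d =>
        (∑ j : ι, ∑ k' : Fin d, |((1 : Matrix (Fin d) (Fin d) ℝ) - (H j)ᵀ * H j) k' k|) /
          ((Fintype.card ι : ℝ) - b)))
    (hρ1 : ρ < 1)
    (hC₀ : C₀ = Finset.univ.sup' Finset.univ_nonempty (fun j : ι =>
        ‖LinearMap.toContinuousLinearMap (Matrix.toEuclideanLin (H j))‖))
    (x : ι → ℕ → Fin d → ℝ)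
    (β : ι → ι → Fin d → ℕ → ℝ)
    (hβnn : ∀ i j k t, 1 ≤ t → 0 ≤ β i j k t)
    (hβub : ∀ i j k t, 1 ≤ t → β i j k t ≤ ((Fintype.card ι : ℝ) - b)⁻¹)
    (hβsum : ∀ i k t, 1 ≤ t → ∑ j, β i j k t = 1)
    (hdyn : ∀ i k t, 1 ≤ t → x i t k = ∑ j, β i j k t *
        (x j (t - 1) k - (((H j)ᵀ * H j) *ᵥ (x j (t - 1) - θ)) k +
          ((H j)ᵀ *ᵥ (fun a => ((t : ℝ)⁻¹ • ∑ r ∈ Finset.range t, w j r) a)) k)) :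
    ∀ t, 1 ≤ t →
      Finset.univ.sup' Finset.univ_nonempty (fun i => ‖x i t - θ‖) ≤
        ρ ^ t * Finset.univ.sup' Finset.univ_nonempty (fun i => ‖x i 0 - θ‖) +
          C₀ * ∑ j : ι, ∑ m ∈ Finset.range t,
            ρ ^ m * ‖(((t : ℝ) - m)⁻¹) • ∑ r ∈ Finset.range (t - m), w j r‖ := by
  have hc : 0 < (Fintype.card ι : ℝ) - b := sub_pos.2 (by exact_mod_cast hb)
  have hρk : ∀ k : Fin d, (∑ j : ι, ∑ k' : Fin d,
      |((1 : Matrix (Fin d) (Fin d) ℝ) - (H j)ᵀ * H j) k' k|) / ((Fintype.card ι : ℝ) - b) ≤ ρ :=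
    fun k => hρ ▸ Finset.le_sup' (fun k : Fin d => (∑ j : ι, ∑ k' : Fin d,
      |((1 : Matrix (Fin d) (Fin d) ℝ) - (H j)ᵀ * H j) k' k|) / ((Fintype.card ι : ℝ) - b))
      (Finset.mem_univ k)
  have hρ0 : 0 ≤ ρ := le_trans (by positivity) (hρk 0)
  have hC : ∀ j, ‖LinearMap.toContinuousLinearMap (Matrix.toEuclideanLin (H j))‖ ≤ C₀ :=
    fun j => hC₀ ▸ Finset.le_sup' (fun j : ι =>
      ‖LinearMap.toContinuousLinearMap (Matrix.toEuclideanLin (H j))‖) (Finset.mem_univ j)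
  have hC0 : 0 ≤ C₀ := (norm_nonneg _).trans (hC (Classical.arbitrary ι))
  set M : ℕ → ℝ := fun t => Finset.univ.sup' Finset.univ_nonempty (fun i => ‖x i t - θ‖) with hM
  have hMle : ∀ t j, ‖x j t - θ‖ ≤ M t := fun t j =>
    Finset.le_sup' (fun i => ‖x i t - θ‖) (Finset.mem_univ j)
  have hM0 : ∀ t, 0 ≤ M t := fun t => (norm_nonneg _).trans (hMle t (Classical.arbitrary ι))
  set u : ι → ℕ → ℝ := fun j t => ‖(t : ℝ)⁻¹ • ∑ r ∈ Finset.range t, w j r‖ with hu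
  have hstep : ∀ t, M (t + 1) ≤ ρ * M t + C₀ * ∑ j, u j (t + 1) := by
    intro t
    have ht : 1 ≤ t + 1 := Nat.le_add_left 1 t
    have hR0 : 0 ≤ ρ * M t + C₀ * ∑ j, u j (t + 1) :=
      add_nonneg (mul_nonneg hρ0 (hM0 t))
        (mul_nonneg hC0 (Finset.sum_nonneg fun j _ => norm_nonneg _))
    refine Finset.sup'_le _ _ fun i _ => (pi_norm_le_iff_of_nonneg hR0).2 fun k => ?_
    have herr : (x i (t + 1) - θ) k =
        ∑ j, β i j k (t + 1) * (((1 - (H j)ᵀ * H j) *ᵥ (x j t - θ)) k) +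
        ∑ j, β i j k (t + 1) * (((H j)ᵀ *ᵥ
          (fun a => (((t + 1 : ℕ) : ℝ)⁻¹ • ∑ r ∈ Finset.range (t + 1), w j r) a)) k) := by
      rw [Pi.sub_apply, hdyn i k (t + 1) ht, ← one_mul (θ k), ← hβsum i k (t + 1) ht,
        Finset.sum_mul, ← Finset.sum_sub_distrib, ← Finset.sum_add_distrib]
      refine Finset.sum_congr rfl fun j _ => ?_
      rw [Matrix.sub_mulVec, Matrix.one_mulVec, Pi.sub_apply, Pi.sub_apply, Nat.add_sub_cancel]
      ring
    rw [Real.norm_eq_abs, herr]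
    refine (abs_add_le _ _).trans (add_le_add ?_ ?_)
    · calc |∑ j, β i j k (t + 1) * (((1 - (H j)ᵀ * H j) *ᵥ (x j t - θ)) k)|
          ≤ ∑ j, |β i j k (t + 1) * (((1 - (H j)ᵀ * H j) *ᵥ (x j t - θ)) k)| :=
            Finset.abs_sum_le_sum_abs _ _
        _ ≤ ∑ j, ((Fintype.card ι : ℝ) - b)⁻¹ *
              ((∑ k', |((1 : Matrix (Fin d) (Fin d) ℝ) - (H j)ᵀ * H j) k' k|) * M t) := by
            refine Finset.sum_le_sum fun j _ => ?_
            have hsymm : ((1 : Matrix (Fin d) (Fin d) ℝ) - (H j)ᵀ * H j).IsSymm := by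
              simp [Matrix.IsSymm, Matrix.transpose_mul]
            rw [abs_mul, abs_of_nonneg (hβnn i j k (t + 1) ht)]
            refine mul_le_mul (hβub i j k (t + 1) ht) ?_ (abs_nonneg _) (inv_nonneg.2 hc.le)
            simp_rw [fun k' => hsymm.apply k k']
            exact (abs_mulVec_le_sum_abs_mul_norm _ _ k).trans
              (mul_le_mul_of_nonneg_left (hMle t j) (by positivity))
        _ = (∑ j : ι, ∑ k' : Fin d, |((1 : Matrix (Fin d) (Fin d) ℝ) - (H j)ᵀ * H j) k' k|) /
              ((Fintype.card ι : ℝ) - b) * M t := by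
            rw [← Finset.mul_sum, ← Finset.sum_mul, div_eq_inv_mul, mul_assoc]
        _ ≤ ρ * M t := mul_le_mul_of_nonneg_right (hρk k) (hM0 t)
    · rw [Finset.mul_sum]
      refine (Finset.abs_sum_le_sum_abs _ _).trans (Finset.sum_le_sum fun j _ => ?_)
      have hβ1 : β i j k (t + 1) ≤ 1 := hβsum i k (t + 1) ht ▸
        Finset.single_le_sum (f := fun j => β i j k (t + 1))
          (fun j _ => hβnn i j k (t + 1) ht) (Finset.mem_univ j)
      rw [abs_mul, abs_of_nonneg (hβnn i j k (t + 1) ht)]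
      refine (mul_le_of_le_one_left (abs_nonneg _) hβ1).trans ?_
      exact (abs_transpose_mulVec_le _ _ k).trans
        (mul_le_mul_of_nonneg_right (hC j) (norm_nonneg _))
  intro t _
  refine (le_pow_mul_add_sum_of_succ_le (g := fun t => C₀ * ∑ j, u j t) hρ0 hstep t).trans_eq ?_
  congr 1
  rw [Finset.sum_comm, Finset.mul_sum]
  refine Finset.sum_congr rfl fun m hm => ?_
  rw [← Finset.mul_sum, mul_left_comm]
  simp only [hu, Nat.cast_sub (Finset.mem_range.1 hm).le]
end

section
/- Let φ ≥ 1 and N ≥ 1 be integers, γ ∈ (0,1), and for each t ≥ 1 let M(t) be a φ×φ real matrix with nonnegative entries and all row sums at most 1, such that for every t₀ ≥ 0 the ordered product M(t₀+N)⋯M(t₀+1) has all row sums at most γ. Suppose the vectors E(t) ∈ ℝ^φ have nonnegative entries and satisfy, entrywise, E(t) ≤ M(t) E(t−1) + u(t) 𝟙 for all t ≥ 1, where u(t) ≥ 0 and 𝟙 is the all-ones vector. Then for every t ≥ 1, entrywise, E(t) ≤ γ^{⌊t/N⌋} (max_i E_i(0)) 𝟙 + Σ_{m=0}^{t−1} u(t−m)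 γ^{⌊m/N⌋} 𝟙. -/
/-- The ordered product `M (t₀ + N) * M (t₀ + N - 1) * ⋯ * M (t₀ + 1)` of `N` consecutive
matrices from the sequence `M`. -/
noncomputable def prodDesc {φ : ℕ} (M : ℕ → Matrix (Fin φ) (Fin φ) ℝ) (t₀ N : ℕ) :
    Matrix (Fin φ) (Fin φ) ℝ :=
  ((List.range N).map (fun s => M (t₀ + N - s))).prod

section

variable {φ : ℕ} {M : ℕ → Matrix (Fin φ) (Fin φ) ℝ}

theorem prodDesc_zero (t₀ : ℕ) : prodDesc M t₀ 0 = 1 := by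
  simp [prodDesc]

theorem prodDesc_succ (t₀ k : ℕ) :
    prodDesc M t₀ (k + 1) = M (t₀ + k + 1) * prodDesc M t₀ k := by
  simp only [prodDesc, List.range_succ_eq_map, List.map_cons, List.map_map, List.prod_cons]
  congr 3
  funext s
  simp only [Function.comp_apply]
  congr 1
  omega

theorem prodDesc_add (t₀ a b : ℕ) :
    prodDesc M t₀ (a + b) = prodDesc M (t₀ + a) b * prodDesc M t₀ a := by
  induction b with
  | zero => simp [prodDesc_zero]
  | succ b ih => rw [← add_assoc, prodDesc_succ, ih, prodDesc_succ, mul_assoc, add_assoc t₀ a b]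

theorem prodDesc_succ' (t₀ k : ℕ) :
    prodDesc M t₀ (k + 1) = prodDesc M (t₀ + 1) k * M (t₀ + 1) := by
  rw [add_comm k 1, prodDesc_add, ← zero_add 1, prodDesc_succ, prodDesc_zero, mul_one]
  simp

theorem prodDesc_nonneg (hnn : ∀ t, 1 ≤ t → ∀ i j, 0 ≤ M t i j) (t₀ k : ℕ) (i j : Fin φ) :
    0 ≤ prodDesc M t₀ k i j := by
  induction k generalizing i j with
  | zero =>
    rw [prodDesc_zero, Matrix.one_apply]
    split_ifs <;> norm_num
  | succ k ih =>
    rw [prodDesc_succ, Matrix.mul_apply]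
    exact Finset.sum_nonneg fun l _ => mul_nonneg (hnn _ (by omega) i l) (ih l j)

theorem sum_mul_row_le {A B : Matrix (Fin φ) (Fin φ) ℝ} {a b : ℝ} (hA : ∀ i j, 0 ≤ A i j)
    (hb : 0 ≤ b) (hAa : ∀ i, ∑ j, A i j ≤ a) (hBb : ∀ i, ∑ j, B i j ≤ b) (i : Fin φ) :
    ∑ j, (A * B) i j ≤ a * b := by
  calc ∑ j, (A * B) i j = ∑ l, A i l * ∑ j, B l j := by
        simp only [Matrix.mul_apply, Finset.mul_sum]
        exact Finset.sum_comm
    _ ≤ ∑ l, A i l * b := Finset.sum_le_sum fun l _ => mul_le_mul_of_nonneg_left (hBb l) (hA i l)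
    _ = (∑ l, A i l) * b := (Finset.sum_mul ..).symm
    _ ≤ a * b := mul_le_mul_of_nonneg_right (hAa i) hb

theorem sum_prodDesc_row_le_one (hnn : ∀ t, 1 ≤ t → ∀ i j, 0 ≤ M t i j)
    (hrow : ∀ t, 1 ≤ t → ∀ i, ∑ j, M t i j ≤ 1) (t₀ k : ℕ) (i : Fin φ) :
    ∑ j, prodDesc M t₀ k i j ≤ 1 := by
  induction k generalizing i with
  | zero => simp [prodDesc_zero, Matrix.one_apply]
  | succ k ih =>
    rw [prodDesc_succ]
    simpa using sum_mul_row_le (hnn _ (by omega)) zero_le_one (hrow _ (by omega)) ih i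

theorem sum_prodDesc_row_le_pow {N : ℕ} (hN : 1 ≤ N) {γ : ℝ} (hγ : 0 ≤ γ)
    (hnn : ∀ t, 1 ≤ t → ∀ i j, 0 ≤ M t i j) (hrow : ∀ t, 1 ≤ t → ∀ i, ∑ j, M t i j ≤ 1)
    (hprod : ∀ t₀ : ℕ, ∀ i, ∑ j, prodDesc M t₀ N i j ≤ γ) (t₀ k : ℕ) (i : Fin φ) :
    ∑ j, prodDesc M t₀ k i j ≤ γ ^ (k / N) := by
  induction k using Nat.strong_induction_on generalizing t₀ i with
  | _ k ih =>
    rcases lt_or_ge k N with hk | hk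
    · simpa [Nat.div_eq_of_lt hk] using sum_prodDesc_row_le_one hnn hrow t₀ k i
    · obtain ⟨l, rfl⟩ := Nat.exists_eq_add_of_le hk
      rw [prodDesc_add, Nat.add_div_left l hN, pow_succ]
      exact sum_mul_row_le (prodDesc_nonneg hnn _ _) hγ (ih l (by omega) _) (hprod t₀) i

theorem le_prodDesc_mulVec_add {c : ℕ → ℝ} (hnn : ∀ t, 1 ≤ t → ∀ i j, 0 ≤ M t i j)
    (hc : ∀ t₀ k i, ∑ j, prodDesc M t₀ k i j ≤ c k) {E : ℕ → Fin φ → ℝ} {u : ℕ → ℝ}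
    (hu : ∀ t, 1 ≤ t → 0 ≤ u t)
    (hrec : ∀ t, 1 ≤ t → ∀ i, E t i ≤ (M t).mulVec (E (t - 1)) i + u t)
    (t₀ k : ℕ) (i : Fin φ) :
    E (t₀ + k) i ≤ (prodDesc M t₀ k).mulVec (E t₀) i +
      ∑ m ∈ Finset.range k, u (t₀ + k - m) * c m := by
  induction k generalizing t₀ with
  | zero => simp [prodDesc_zero]
  | succ k ih =>
    have h := ih (t₀ + 1)
    have hstep : (prodDesc M (t₀ + 1) k).mulVec (E (t₀ + 1)) i ≤
        (prodDesc M t₀ (k + 1)).mulVec (E t₀) i + u (t₀ + 1) * c k := by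
      rw [prodDesc_succ', ← Matrix.mulVec_mulVec]
      set P := prodDesc M (t₀ + 1) k
      calc P.mulVec (E (t₀ + 1)) i
          = ∑ j, P i j * E (t₀ + 1) j := rfl
        _ ≤ ∑ j, P i j * ((M (t₀ + 1)).mulVec (E t₀) j + u (t₀ + 1)) :=
            Finset.sum_le_sum fun j _ => mul_le_mul_of_nonneg_left
              (hrec (t₀ + 1) (by omega) j) (prodDesc_nonneg hnn _ _ _ _)
        _ = P.mulVec ((M (t₀ + 1)).mulVec (E t₀)) i + u (t₀ + 1) * ∑ j, P i j := by
            simp only [mul_add, Finset.sum_add_distrib, ← Finset.sum_mul]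
            rw [mul_comm (u _)]
            rfl
        _ ≤ _ := by
            gcongr
            · exact hu _ (by omega)
            · exact hc _ _ _
    rw [Finset.sum_range_succ, show t₀ + (k + 1) = t₀ + 1 + k by omega, Nat.add_sub_cancel]
    linarith

end

/-- **Deterministic linear recursion bound.**
If the nonnegative vectors `E t` satisfy, entrywise, `E t ≤ M t (E (t-1)) + u t • 𝟙` where the
matrices `M t` are nonnegative with row sums at most `1` and every ordered product of `N`
consecutive matrices has row sums at most `γ ∈ (0,1)`, then entrywise
`E t ≤ γ^⌊t/N⌋ (maxᵢ Eᵢ(0)) 𝟙 + (∑_{m=0}^{t-1} u (t-m) γ^⌊m/N⌋) 𝟙`. -/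
theorem stmt15 (φ N : ℕ) [NeZero φ] (hN : 1 ≤ N)
    (γ : ℝ) (hγ0 : 0 < γ) (hγ1 : γ < 1)
    (M : ℕ → Matrix (Fin φ) (Fin φ) ℝ)
    (hnn : ∀ t, 1 ≤ t → ∀ i j, 0 ≤ M t i j)
    (hrow : ∀ t, 1 ≤ t → ∀ i, ∑ j, M t i j ≤ 1)
    (hprod : ∀ t₀ : ℕ, ∀ i, ∑ j, prodDesc M t₀ N i j ≤ γ)
    (E : ℕ → Fin φ → ℝ) (hE : ∀ t i, 0 ≤ E t i)
    (u : ℕ → ℝ) (hu : ∀ t, 1 ≤ t → 0 ≤ u t)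
    (hrec : ∀ t, 1 ≤ t → ∀ i, E t i ≤ (M t).mulVec (E (t - 1)) i + u t) :
    ∀ t, 1 ≤ t → ∀ i,
      E t i ≤ γ ^ (t / N) * (Finset.univ.sup' Finset.univ_nonempty (E 0)) +
        ∑ m ∈ Finset.range t, u (t - m) * γ ^ (m / N) := by
  intro t _ i
  have hpow := sum_prodDesc_row_le_pow hN hγ0.le hnn hrow hprod
  have h := le_prodDesc_mulVec_add (c := fun m => γ ^ (m / N)) hnn hpow hu hrec 0 t i
  rw [zero_add] at h
  refine h.trans (add_le_add_left ?_ _)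
  have hmax : ∀ j, E 0 j ≤ Finset.univ.sup' Finset.univ_nonempty (E 0) :=
    fun j => Finset.le_sup' (E 0) (Finset.mem_univ j)
  calc (prodDesc M 0 t).mulVec (E 0) i
      = ∑ j, prodDesc M 0 t i j * E 0 j := rfl
    _ ≤ ∑ j, prodDesc M 0 t i j * Finset.univ.sup' Finset.univ_nonempty (E 0) :=
        Finset.sum_le_sum fun j _ =>
          mul_le_mul_of_nonneg_left (hmax j) (prodDesc_nonneg hnn _ _ _ _)
    _ = (∑ j, prodDesc M 0 t i j) * Finset.univ.sup' Finset.univ_nonempty (E 0) :=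
        (Finset.sum_mul ..).symm
    _ ≤ _ := mul_le_mul_of_nonneg_right (hpow 0 t i) ((hE 0 i).trans (hmax i))
end
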